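/- Let k be a field, V a finite-dimensional k-vector space, 2 ≤ a < b integers, and R_a ⊆ V^{⊗a}, R_b ⊆ V^{⊗b} subspaces. For s ∈ {a,b} set R_s^⊥ := Φ_s^{-1}(Ann(R_s)) ⊆ (V*)^{⊗s} and define J(R_s)_n := V^{⊗n} for 0 ≤ n < s and J(R_s)_n := ⋂_{i+j+s=n} V^{⊗i}⊗R_s⊗V^{⊗j} for n ≥ s. Then for every n ≥ 0, Σ_{i+j+a=n} (V*)^{⊗i}⊗R_a^⊥⊗(V*)^{⊗j} + Σ_{h+l+b=n} (V*)^{⊗h}⊗R_b^⊥⊗(V*)^{⊗l} = Φ_n^{-1}(Ann(J(R_a)_n)) + Φ_n^{-1}(Ann(J(R_b)_n)), where empty sums are the zero subspace. -/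

import Mathlib

/-- The degree-`n` component `V^{⊗n}` of the tensor algebra of `V`, realized as the
`n`-th power of the image of `V` in `T(V)`.  Via the canonical identification of the
tensor algebra with `⊕ₙ V^{⊗n}`, a subspace of `V^{⊗n}` is a submodule of `T(V)`
contained in `tpow k V n`, and the tensor product of subspaces corresponds to the
multiplication of submodules of the algebra `T(V)`. -/
noncomputable def tpow (k V : Type*) [CommSemiring k] [AddCommMonoid V] [Module k V]
    (n : ℕ) : Submodule k (TensorAlgebra k V) :=
  (LinearMap.range (TensorAlgebra.ι k (M := V))) ^ n

/-- `J(R_s)_n`: it is `V^{⊗n}` for `0 ≤ n < s` and `⋂_{i+j+s=n} V^{⊗i}⊗R⊗V^{⊗j}`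
for `n ≥ s`. -/
noncomputable def JR (k V : Type*) [CommSemiring k] [AddCommMonoid V] [Module k V]
    (s : ℕ) (R : Submodule k (TensorAlgebra k V)) (n : ℕ) :
    Submodule k (TensorAlgebra k V) :=
  if n < s then tpow k V n
  else ⨅ (i : ℕ) (j : ℕ) (_ : i + j + s = n), tpow k V i * R * tpow k V j

/-- `R^⊥ := Φ s ⁻¹ (Ann R) ⊆ (V*)^{⊗s}`, for a subspace `R ⊆ V^{⊗s}`, viewed as a
subspace of the tensor algebra `T(V*)`. -/
noncomputable def rperp (k V : Type*) [Field k] [AddCommGroup V] [Module k V]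
    (Φ : ∀ n : ℕ, ↥(tpow k (Module.Dual k V) n) ≃ₗ[k] Module.Dual k ↥(tpow k V n))
    (s : ℕ) (R : Submodule k (TensorAlgebra k V)) :
    Submodule k (TensorAlgebra k (Module.Dual k V)) :=
  Submodule.map (tpow k (Module.Dual k V) s).subtype
    (Submodule.comap (Φ s).toLinearMap
      (Submodule.dualAnnihilator (Submodule.comap (tpow k V s).subtype R)))

section TensorPower

open Module

variable {k V : Type*} [CommSemiring k] [AddCommMonoid V] [Module k V]

theorem tpow_add (p q : ℕ) : tpow k V (p + q) = tpow k V p * tpow k V q :=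
  pow_add _ p q

theorem ofFn_prod_mem_tpow {n : ℕ} (v : Fin n → V) :
    (List.ofFn fun i => TensorAlgebra.ι k (v i)).prod ∈ tpow k V n := by
  rw [tpow, Submodule.pow_eq_span_pow_set]
  exact Submodule.subset_span
    (Set.mem_pow.2 ⟨fun i => ⟨_, LinearMap.mem_range_self _ (v i)⟩, rfl⟩)

/-- The pure tensor `v₁ ⊗ ⋯ ⊗ vₙ` as an element of `tpow k V n`. -/
noncomputable def pureTensor {n : ℕ} (v : Fin n → V) : tpow k V n :=
  ⟨(List.ofFn fun i => TensorAlgebra.ι k (v i)).prod, ofFn_prod_mem_tpow v⟩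

theorem tpow_induction {n : ℕ} {motive : tpow k V n → Prop}
    (pure : ∀ v : Fin n → V, motive (pureTensor v))
    (zero : motive 0)
    (add : ∀ x y, motive x → motive y → motive (x + y))
    (smul : ∀ (c : k) x, motive x → motive (c • x)) (x : tpow k V n) : motive x := by
  obtain ⟨x, hx⟩ := x
  have hx' := hx
  rw [tpow, Submodule.pow_eq_span_pow_set] at hx'
  suffices ∃ h : x ∈ tpow k V n, motive ⟨x, h⟩ from this.2
  induction hx' using Submodule.span_induction with
  | mem x h =>
    obtain ⟨f, rfl⟩ := Set.mem_pow.1 h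
    choose v hv using fun i => (f i).2
    have key : (List.ofFn fun i => (f i : TensorAlgebra k V)).prod =
        (List.ofFn fun i => TensorAlgebra.ι k (v i)).prod := by simp only [hv]
    rw [key]
    exact ⟨_, pure v⟩
  | zero => exact ⟨_, zero⟩
  | add x y hx hy ihx ihy =>
    obtain ⟨hx, ihx⟩ := ihx (by rwa [tpow, Submodule.pow_eq_span_pow_set])
    obtain ⟨hy, ihy⟩ := ihy (by rwa [tpow, Submodule.pow_eq_span_pow_set])
    exact ⟨_, add _ _ ihx ihy⟩
  | smul c x hx ih =>
    obtain ⟨hx, ih⟩ := ih (by rwa [tpow, Submodule.pow_eq_span_pow_set])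
    exact ⟨_, smul c _ ih⟩

/-- The multiplication `V^{⊗p} × V^{⊗q} → V^{⊗(p+q)}`. -/
noncomputable def tpowMul (p q : ℕ) :
    tpow k V p →ₗ[k] tpow k V q →ₗ[k] tpow k V (p + q) :=
  LinearMap.mk₂ k
    (fun x y => ⟨x * y, by rw [tpow_add]; exact Submodule.mul_mem_mul x.2 y.2⟩)
    (fun _ _ _ => Subtype.ext (add_mul _ _ _))
    (fun _ _ _ => Subtype.ext (smul_mul_assoc _ _ _))
    (fun _ _ _ => Subtype.ext (mul_add _ _ _))
    (fun _ _ _ => Subtype.ext (mul_smul_comm _ _ _))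

@[simp]
theorem coe_tpowMul {p q : ℕ} (x : tpow k V p) (y : tpow k V q) :
    (tpowMul p q x y : TensorAlgebra k V) = x * y := rfl

theorem tpowMul_pureTensor {p q : ℕ} (u : Fin p → V) (v : Fin q → V) :
    tpowMul p q (pureTensor u) (pureTensor v) = pureTensor (k := k) (Fin.append u v) := by
  ext
  simp only [coe_tpowMul, pureTensor, ← List.prod_append, ← List.ofFn_fin_append]
  congr 2
  ext i
  refine Fin.addCases (fun i => ?_) (fun i => ?_) i <;> simp

theorem exists_eq_sum_tpowMul_left {p q : ℕ} {ι : Type*} [Fintype ι]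
    (b : Basis ι k (tpow k V p)) (z : tpow k V (p + q)) :
    ∃ y : ι → tpow k V q, z = ∑ i, tpowMul p q (b i) (y i) := by
  obtain ⟨z, hz⟩ := z
  have hz' := hz
  rw [tpow_add] at hz'
  suffices ∃ y : ι → tpow k V q, z = ∑ i, (b i : TensorAlgebra k V) * y i by
    obtain ⟨y, hy⟩ := this
    exact ⟨y, Subtype.ext (by simpa using hy)⟩
  clear hz
  induction hz' using Submodule.mul_induction_on' with
  | mem_mul_mem x hx y hy =>
    refine ⟨fun i => b.repr ⟨x, hx⟩ i • ⟨y, hy⟩, ?_⟩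
    have h := congrArg Subtype.val (b.sum_repr ⟨x, hx⟩)
    simp only [Submodule.coe_sum, Submodule.coe_smul] at h
    nth_rewrite 1 [← h]
    simp [Finset.sum_mul]
  | add x _ y _ ihx ihy =>
    obtain ⟨f, rfl⟩ := ihx
    obtain ⟨g, rfl⟩ := ihy
    exact ⟨f + g, by simp [mul_add, Finset.sum_add_distrib]⟩

theorem exists_eq_sum_tpowMul_right {p q : ℕ} {ι : Type*} [Fintype ι]
    (b : Basis ι k (tpow k V q)) (z : tpow k V (p + q)) :
    ∃ y : ι → tpow k V p, z = ∑ i, tpowMul p q (y i) (b i) := by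
  obtain ⟨z, hz⟩ := z
  have hz' := hz
  rw [tpow_add] at hz'
  suffices ∃ y : ι → tpow k V p, z = ∑ i, (y i : TensorAlgebra k V) * b i by
    obtain ⟨y, hy⟩ := this
    exact ⟨y, Subtype.ext (by simpa using hy)⟩
  clear hz
  induction hz' using Submodule.mul_induction_on' with
  | mem_mul_mem x hx y hy =>
    refine ⟨fun i => b.repr ⟨y, hy⟩ i • ⟨x, hx⟩, ?_⟩
    have h := congrArg Subtype.val (b.sum_repr ⟨y, hy⟩)
    simp only [Submodule.coe_sum, Submodule.coe_smul] at h
    nth_rewrite 1 [← h]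
    simp [Finset.mul_sum]
  | add x _ y _ ihx ihy =>
    obtain ⟨f, rfl⟩ := ihx
    obtain ⟨g, rfl⟩ := ihy
    exact ⟨f + g, by simp [add_mul, Finset.sum_add_distrib]⟩

end TensorPower

section Perp

open Module

variable {k V : Type*} [Field k] [AddCommGroup V] [Module k V]

instance [FiniteDimensional k V] (n : ℕ) : FiniteDimensional k (tpow k V n) :=
  Module.Finite.iff_fg.2 ((Module.Finite.iff_fg.1 (Module.Finite.range _)).pow n)

variable {Φ : ∀ n : ℕ, tpow k (Dual k V) n ≃ₗ[k] Dual k (tpow k V n)}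

theorem mem_rperp {s : ℕ} {R : Submodule k (TensorAlgebra k V)}
    {x : TensorAlgebra k (Dual k V)} :
    x ∈ rperp k V Φ s R ↔
      ∃ h : x ∈ tpow k (Dual k V) s, ∀ r : tpow k V s, (r : TensorAlgebra k V) ∈ R →
        Φ s ⟨x, h⟩ r = 0 := by
  simp [rperp, Submodule.mem_dualAnnihilator]

theorem coe_mem_rperp {s : ℕ} {R : Submodule k (TensorAlgebra k V)}
    {x : tpow k (Dual k V) s} :
    (x : TensorAlgebra k (Dual k V)) ∈ rperp k V Φ s R ↔
      ∀ r : tpow k V s, (r : TensorAlgebra k V) ∈ R → Φ s x r = 0 := by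
  simp [mem_rperp]

theorem apply_tpowMul
    (hΦ : ∀ (n : ℕ) (f : Fin n → Dual k V) (v : Fin n → V),
      Φ n (pureTensor f) (pureTensor v) = ∏ i, f i (v i))
    {p q : ℕ} (x : tpow k (Dual k V) p) (y : tpow k (Dual k V) q)
    (u : tpow k V p) (v : tpow k V q) :
    Φ (p + q) (tpowMul p q x y) (tpowMul p q u v) = Φ p x u * Φ q y v := by
  induction x using tpow_induction with
  | zero => simp
  | add x x' h h' => simp [h, h', add_mul]
  | smul c x h => simp [h, mul_assoc]
  | pure f =>
  induction y using tpow_induction with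
  | zero => simp
  | add x x' h h' => simp [h, h', mul_add]
  | smul c x h => simp [h, mul_left_comm]
  | pure g =>
  induction u using tpow_induction with
  | zero => simp
  | add x x' h h' => simp [h, h', add_mul]
  | smul c x h => simp [h, mul_assoc]
  | pure u =>
  induction v using tpow_induction with
  | zero => simp
  | add x x' h h' => simp [h, h', mul_add]
  | smul c x h => simp [h, mul_left_comm]
  | pure v => simp [tpowMul_pureTensor, hΦ, Fin.prod_univ_add]

theorem rperp_iInf {ι : Type*} [Finite ι] (n : ℕ)
    (W : ι → Submodule k (TensorAlgebra k V)) :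
    rperp k V Φ n (⨅ i, W i) = ⨆ i, rperp k V Φ n (W i) := by
  simp only [rperp, Submodule.comap_iInf, Subspace.dualAnnihilator_iInf_eq,
    Submodule.comap_equiv_eq_map_symm, Submodule.map_iSup]

variable [FiniteDimensional k V]

theorem rperp_tpow_mul
    (hΦ : ∀ (n : ℕ) (f : Fin n → Dual k V) (v : Fin n → V),
      Φ n (pureTensor f) (pureTensor v) = ∏ i, f i (v i))
    (p q : ℕ) {W : Submodule k (TensorAlgebra k V)} (hW : W ≤ tpow k V q) :
    rperp k V Φ (p + q) (tpow k V p * W) = tpow k (Dual k V) p * rperp k V Φ q W := by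
  apply le_antisymm
  · intro z hz
    obtain ⟨hzt, hz⟩ := mem_rperp.1 hz
    let b := Module.finBasis k (tpow k V p)
    obtain ⟨y, hy⟩ := exists_eq_sum_tpowMul_left (b.dualBasis.map (Φ p).symm) ⟨z, hzt⟩
    rw [hy] at hz
    rw [show z = _ from congrArg Subtype.val hy, Submodule.coe_sum]
    refine Submodule.sum_mem _ fun i _ => Submodule.mul_mem_mul (Subtype.prop _) ?_
    refine coe_mem_rperp.2 fun r hr => ?_
    have := hz (tpowMul p q (b i) r) (Submodule.mul_mem_mul (b i).2 hr)
    simpa [apply_tpowMul hΦ, Finsupp.single_apply] using this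
  · refine Submodule.mul_le.2 fun x hx y hy => ?_
    obtain ⟨hyt, hy⟩ := mem_rperp.1 hy
    refine (coe_mem_rperp (x := tpowMul p q ⟨x, hx⟩ ⟨y, hyt⟩)).2 fun ⟨r, hrt⟩ hr => ?_
    suffices ∃ h, Φ (p + q) (tpowMul p q ⟨x, hx⟩ ⟨y, hyt⟩) ⟨r, h⟩ = 0 from this.2
    change r ∈ _ at hr
    clear hrt
    induction hr using Submodule.mul_induction_on' with
    | mem_mul_mem u hu w hw =>
      refine ⟨(tpowMul p q ⟨u, hu⟩ ⟨w, hW hw⟩).2, ?_⟩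
      refine (apply_tpowMul hΦ _ _ ⟨u, hu⟩ ⟨w, hW hw⟩).trans ?_
      rw [hy _ hw, mul_zero]
    | add u _ v _ ihu ihv =>
      obtain ⟨hu, ihu⟩ := ihu
      obtain ⟨hv, ihv⟩ := ihv
      refine ⟨add_mem hu hv, ?_⟩
      rw [← AddMemClass.mk_add_mk _ u v hu hv, map_add, ihu, ihv, add_zero]

theorem rperp_mul_tpow
    (hΦ : ∀ (n : ℕ) (f : Fin n → Dual k V) (v : Fin n → V),
      Φ n (pureTensor f) (pureTensor v) = ∏ i, f i (v i))
    (p q : ℕ) {W : Submodule k (TensorAlgebra k V)} (hW : W ≤ tpow k V p) :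
    rperp k V Φ (p + q) (W * tpow k V q) = rperp k V Φ p W * tpow k (Dual k V) q := by
  apply le_antisymm
  · intro z hz
    obtain ⟨hzt, hz⟩ := mem_rperp.1 hz
    let b := Module.finBasis k (tpow k V q)
    obtain ⟨y, hy⟩ := exists_eq_sum_tpowMul_right (b.dualBasis.map (Φ q).symm) ⟨z, hzt⟩
    rw [hy] at hz
    rw [show z = _ from congrArg Subtype.val hy, Submodule.coe_sum]
    refine Submodule.sum_mem _ fun i _ => Submodule.mul_mem_mul ?_ (Subtype.prop _)
    refine coe_mem_rperp.2 fun r hr => ?_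
    have := hz (tpowMul p q r (b i)) (Submodule.mul_mem_mul hr (b i).2)
    simpa [apply_tpowMul hΦ, Finsupp.single_apply] using this
  · refine Submodule.mul_le.2 fun x hx y hy => ?_
    obtain ⟨hxt, hx⟩ := mem_rperp.1 hx
    refine (coe_mem_rperp (x := tpowMul p q ⟨x, hxt⟩ ⟨y, hy⟩)).2 fun ⟨r, hrt⟩ hr => ?_
    suffices ∃ h, Φ (p + q) (tpowMul p q ⟨x, hxt⟩ ⟨y, hy⟩) ⟨r, h⟩ = 0 from this.2
    change r ∈ _ at hr
    clear hrt
    induction hr using Submodule.mul_induction_on' with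
    | mem_mul_mem w hw u hu =>
      refine ⟨(tpowMul p q ⟨w, hW hw⟩ ⟨u, hu⟩).2, ?_⟩
      refine (apply_tpowMul hΦ _ _ ⟨w, hW hw⟩ ⟨u, hu⟩).trans ?_
      rw [hx _ hw, zero_mul]
    | add u _ v _ ihu ihv =>
      obtain ⟨hu, ihu⟩ := ihu
      obtain ⟨hv, ihv⟩ := ihv
      refine ⟨add_mem hu hv, ?_⟩
      rw [← AddMemClass.mk_add_mk _ u v hu hv, map_add, ihu, ihv, add_zero]

theorem rperp_JR
    (hΦ : ∀ (n : ℕ) (f : Fin n → Dual k V) (v : Fin n → V),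
      Φ n (pureTensor f) (pureTensor v) = ∏ i, f i (v i))
    (s : ℕ) {R : Submodule k (TensorAlgebra k V)} (hR : R ≤ tpow k V s) (n : ℕ) :
    rperp k V Φ n (JR k V s R n) =
      ⨆ (i : ℕ) (j : ℕ) (_ : i + j + s = n),
        tpow k (Dual k V) i * rperp k V Φ s R * tpow k (Dual k V) j := by
  let I := {x : ℕ × ℕ // x.1 + x.2 + s = n}
  have hI : Finite I := ((Set.finite_Iic n).prod (Set.finite_Iic n)).subset
    (fun x (hx : x.1 + x.2 + s = n) => ⟨by simp; omega, by simp; omega⟩)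
  have hJ : rperp k V Φ n (JR k V s R n) =
      rperp k V Φ n (⨅ x : I, tpow k V x.1.1 * R * tpow k V x.1.2) := by
    rw [JR]
    split_ifs with h
    · have : IsEmpty I := ⟨fun x => by have := x.2; omega⟩
      simp [rperp, iInf_of_empty]
    · simp only [I, iInf_subtype, iInf_prod]
  rw [hJ, rperp_iInf]
  simp only [I, iSup_subtype, iSup_prod]
  refine iSup_congr fun i => iSup_congr fun j => iSup_congr fun h => ?_
  obtain rfl : i + s + j = n := by omega
  rw [rperp_mul_tpow hΦ _ _ (by rw [tpow_add]; exact mul_le_mul_right hR _),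
    rperp_tpow_mul hΦ _ _ hR]

end Perp

/-- with `2 ≤ a < b`, subspaces `R_a ⊆ V^{⊗a}`, `R_b ⊆ V^{⊗b}` of the
finite-dimensional space's tensor powers, and `Φ` the canonical isomorphisms
`(V*)^{⊗n} ≃ (V^{⊗n})*`, one has, for every `n`,
`Σ_{i+j+a=n} (V*)^{⊗i}⊗R_a^⊥⊗(V*)^{⊗j} + Σ_{h+l+b=n} (V*)^{⊗h}⊗R_b^⊥⊗(V*)^{⊗l}
  = Φ_n⁻¹(Ann J(R_a)_n) + Φ_n⁻¹(Ann J(R_b)_n)`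
(empty sums being the zero subspace). -/
theorem stmt12 (k V : Type*) [Field k] [AddCommGroup V] [Module k V]
    [FiniteDimensional k V]
    (Φ : ∀ n : ℕ,
      ↥(tpow k (Module.Dual k V) n) ≃ₗ[k] Module.Dual k ↥(tpow k V n))
    (hΦ : ∀ (n : ℕ) (f : Fin n → Module.Dual k V) (v : Fin n → V)
      (hf : (List.ofFn fun i => TensorAlgebra.ι k (f i)).prod ∈ tpow k (Module.Dual k V) n)
      (hv : (List.ofFn fun i => TensorAlgebra.ι k (v i)).prod ∈ tpow k V n),
      Φ n ⟨(List.ofFn fun i => TensorAlgebra.ι k (f i)).prod, hf⟩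
          ⟨(List.ofFn fun i => TensorAlgebra.ι k (v i)).prod, hv⟩
        = ∏ i, f i (v i))
    (a b : ℕ) (ha : 2 ≤ a) (hab : a < b)
    (Ra Rb : Submodule k (TensorAlgebra k V))
    (hRa : Ra ≤ tpow k V a) (hRb : Rb ≤ tpow k V b)
    (n : ℕ) :
    (⨆ (i : ℕ) (j : ℕ) (_ : i + j + a = n),
        tpow k (Module.Dual k V) i * rperp k V Φ a Ra * tpow k (Module.Dual k V) j)
      ⊔ (⨆ (h : ℕ) (l : ℕ) (_ : h + l + b = n),
          tpow k (Module.Dual k V) h * rperp k V Φ b Rb * tpow k (Module.Dual k V) l)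
    = Submodule.map (tpow k (Module.Dual k V) n).subtype
        (Submodule.comap (Φ n).toLinearMap
          (Submodule.dualAnnihilator ((JR k V a Ra n).comap (tpow k V n).subtype)))
      ⊔ Submodule.map (tpow k (Module.Dual k V) n).subtype
          (Submodule.comap (Φ n).toLinearMap
            (Submodule.dualAnnihilator ((JR k V b Rb n).comap (tpow k V n).subtype))) := by
  have hΦ_pure : ∀ (m : ℕ) (f : Fin m → Module.Dual k V) (v : Fin m → V),
      Φ m (pureTensor f) (pureTensor v) = ∏ i, f i (v i) :=
    fun m f v => hΦ m f v _ _
  rw [← rperp_JR hΦ_pure a hRa, ← rperp_JR hΦ_pure b hRb]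
  rfl
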